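/- Compact representation of the temperature tensor: Let ε > 0, τ > 0, Δt > 0 be real numbers, ν < 1 a real number, ρ > 0, T ∈ ℝ, u ∈ ℝ³, and let Σ*, R be 3×3 real matrices with R = ρ·(T·I + u ⊗ u). Define Σ = ( ε / (ε + (1−ν)τΔt) )·Σ* + ( (1−ν)τΔt / (ε + (1−ν)τΔt) )·R, Θ = Σ/ρ − u ⊗ u, and 𝒯 = ν·Θ + (1−ν)·T·I. Then 𝒯 = (1 − ν′)·T·I + ν′·( Σ*/ρ − u ⊗ u ), where ν′ = εν / (ε + (1−ν)τΔt). -/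

import Mathlib

/-- Compact representation of the temperature tensor. -/
theorem stmt_4 (ε τ Δt ν ρ T : ℝ) (hε : 0 < ε) (hτ : 0 < τ) (hΔt : 0 < Δt)
    (hν : ν < 1) (hρ : 0 < ρ) (u : Fin 3 → ℝ)
    (Sstar R S Θ 𝒯 : Matrix (Fin 3) (Fin 3) ℝ) (ν' : ℝ)
    (hR : R = ρ • (T • (1 : Matrix (Fin 3) (Fin 3) ℝ) + Matrix.vecMulVec u u))
    (hS : S = (ε / (ε + (1 - ν) * τ * Δt)) • Sstar
        + ((1 - ν) * τ * Δt / (ε + (1 - ν) * τ * Δt)) • R)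
    (hΘ : Θ = ρ⁻¹ • S - Matrix.vecMulVec u u)
    (h𝒯 : 𝒯 = ν • Θ + (1 - ν) • (T • (1 : Matrix (Fin 3) (Fin 3) ℝ)))
    (hν' : ν' = ε * ν / (ε + (1 - ν) * τ * Δt)) :
    𝒯 = (1 - ν') • (T • (1 : Matrix (Fin 3) (Fin 3) ℝ))
        + ν' • (ρ⁻¹ • Sstar - Matrix.vecMulVec u u) := by
  have hD : ε + (1 - ν) * τ * Δt ≠ 0 := by
    have : 0 < (1 - ν) * τ * Δt := mul_pos (mul_pos (sub_pos.mpr hν) hτ) hΔt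
    positivity
  have hρ₀ : ρ ≠ 0 := hρ.ne'
  subst hR hS hΘ h𝒯 hν'
  ext i j
  simp only [Matrix.add_apply, Matrix.sub_apply, Matrix.smul_apply, smul_eq_mul]
  field_simp
  ring
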